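/- Let p be a nonnegative integer. Equip ℝᵖ × ℝ with the degenerate quadratic form Q(v,t) = |v|², and equip ℝᵖ × ℝ × ℝ with the quadratic form Q'(v,a,b) = |v|² + a² − b² of signature (p+1,1). The linear map f : ℝᵖ × ℝ → CliffordAlgebra Q' given by f(v,t) = ι'(v, t, t) (sending the degenerate direction to the null vector e₊ + e₋ of the added Minkowski plane) satisfies f(w)² = Q(w)·1 for all w, hence induces an ℝ-algebra homomorphism from CliffordAlgebra Q = Cl(p,0,1) to CliffordAlgebra Q' = Cl(p+1,1); this homomorphism is injective, so the homogeneous algebra Cl(p,0,1) is a subalgebra of the conformal algebra Cl(p+1,1). -/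

import Mathlib

/-- The degenerate quadratic form `Q (v, t) = |v|²` on `ℝᵖ × ℝ`, i.e. the diagonal form of
`Cl(p,0,1)` with `p` coefficients `+1` and one coefficient `0`. -/
noncomputable def homogeneousForm (p : ℕ) : QuadraticForm ℝ ((Fin p → ℝ) × ℝ) :=
  (QuadraticMap.weightedSumSquares ℝ (fun _ : Fin p => (1 : ℝ))).prod 0

/-- The quadratic form `Q' (v, a, b) = |v|² + a² - b²` of signature `(p+1, 1)` on
`ℝᵖ × ℝ × ℝ`, i.e. the diagonal form of the conformal algebra `Cl(p+1,1)`. -/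
noncomputable def conformalForm (p : ℕ) : QuadraticForm ℝ ((Fin p → ℝ) × ℝ × ℝ) :=
  (QuadraticMap.weightedSumSquares ℝ (fun _ : Fin p => (1 : ℝ))).prod
    (QuadraticMap.sq.prod (-QuadraticMap.sq))

/-- The linear map `f (v, t) = ι' (v, t, t)` from `ℝᵖ × ℝ` into `CliffordAlgebra (Q' p)`,
sending the degenerate direction to (the image under `ι'` of) the null vector `e₊ + e₋` of
the added Minkowski plane. -/
noncomputable def homogeneousToConformalMap (p : ℕ) :
    ((Fin p → ℝ) × ℝ) →ₗ[ℝ] CliffordAlgebra (conformalForm p) :=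
  (CliffordAlgebra.ι (conformalForm p)).comp
    ((LinearMap.fst ℝ (Fin p → ℝ) ℝ).prod
      (((LinearMap.snd ℝ (Fin p → ℝ) ℝ)).prod (LinearMap.snd ℝ (Fin p → ℝ) ℝ)))

namespace CliffordAlgebra

variable {R M N : Type*} [CommRing R] [AddCommGroup M] [AddCommGroup N] [Module R M] [Module R N]
  {P : QuadraticForm R M} {Q : QuadraticForm R N}

/-- Contracting by a functional that vanishes on the range of an isometry kills the image of the
induced map of Clifford algebras. -/
theorem contractLeft_map_eq_zero (f : P →qᵢ Q) (d : Module.Dual R N) (hd : ∀ m, d (f m) = 0)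
    (x : CliffordAlgebra P) : contractLeft d (map f x) = 0 := by
  induction x using left_induction with
  | algebraMap r => rw [AlgHom.commutes, contractLeft_algebraMap]
  | add x y hx hy => rw [map_add, map_add, hx, hy, add_zero]
  | ι_mul x m hx =>
    rw [map_mul, map_apply_ι, contractLeft_ι_mul, hd, hx, zero_smul, mul_zero, sub_zero]

/-- An isometry with a linear left inverse induces an injective map of Clifford algebras, even if
the left inverse is not an isometry. -/
theorem map_injective_of_linear_leftInverse [Invertible (2 : R)] (f : P →qᵢ Q) (g : N →ₗ[R] M)
    (hgf : ∀ m, g (f m) = m) : Function.Injective (map f) := by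
  let g' : P.comp g →qᵢ P := ⟨g, fun _ => rfl⟩
  let B : LinearMap.BilinForm R N := QuadraticMap.associated (P.comp g - Q)
  have hB : B.toQuadraticMap = P.comp g - Q := QuadraticMap.toQuadraticMap_associated R _
  have hBf (m m' : M) : B (f m) (f m') = 0 := by
    simp only [B, QuadraticMap.associated_apply, sub_apply, QuadraticMap.comp_apply,
      ← map_add f, hgf, f.map_app, sub_self, smul_zero]
  have hleft : Function.LeftInverse (fun y => map g' (changeForm hB y)) (map f) := by
    intro x
    induction x using left_induction with
    | algebraMap r => simp only [AlgHom.commutes, changeForm_algebraMap]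
    | add x y hx hy => simp only [map_add, hx, hy]
    | ι_mul x m hx =>
      have hgm : g' (f m) = m := hgf m
      simp only [map_mul, map_apply_ι, changeForm_ι_mul, ← changeForm_contractLeft,
        contractLeft_map_eq_zero f _ (hBf m), map_zero, sub_zero, hx, hgm]
  exact hleft.injective

end CliffordAlgebra

/-- The isometric embedding `(v, t) ↦ (v, t, t)` of the homogeneous form into the conformal one. -/
noncomputable def homogeneousToConformalIsometry (p : ℕ) :
    homogeneousForm p →qᵢ conformalForm p where
  toLinearMap := (LinearMap.fst ℝ (Fin p → ℝ) ℝ).prod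
    ((LinearMap.snd ℝ (Fin p → ℝ) ℝ).prod (LinearMap.snd ℝ (Fin p → ℝ) ℝ))
  map_app' w := by simp [homogeneousForm, conformalForm]

/-- The map `f (v, t) = ι' (v, t, t)` satisfies `f w * f w = Q w • 1` (where
`Q (v,t) = |v|²` is the degenerate form of `Cl(p,0,1)`), hence induces an ℝ-algebra
homomorphism `Cl(p,0,1) → Cl(p+1,1)` by the universal property; this homomorphism is
injective, so the homogeneous algebra `Cl(p,0,1)` is a subalgebra of the conformal algebra
`Cl(p+1,1)`. -/
theorem homogeneous_subalgebra_of_conformal (p : ℕ) :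
    (∀ w : (Fin p → ℝ) × ℝ,
      homogeneousToConformalMap p w * homogeneousToConformalMap p w =
        algebraMap ℝ (CliffordAlgebra (conformalForm p)) (homogeneousForm p w)) ∧
    ∀ h : ∀ w : (Fin p → ℝ) × ℝ,
        homogeneousToConformalMap p w * homogeneousToConformalMap p w =
          algebraMap ℝ (CliffordAlgebra (conformalForm p)) (homogeneousForm p w),
      Function.Injective
        (CliffordAlgebra.lift (homogeneousForm p) ⟨homogeneousToConformalMap p, h⟩) := by
  refine ⟨fun w => ?_, fun h => ?_⟩
  · exact (CliffordAlgebra.ι_sq_scalar _ _).trans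
      (congrArg _ ((homogeneousToConformalIsometry p).map_app w))
  · exact CliffordAlgebra.map_injective_of_linear_leftInverse (homogeneousToConformalIsometry p)
      ((LinearMap.fst ℝ _ _).prod (LinearMap.fst ℝ ℝ ℝ ∘ₗ LinearMap.snd ℝ _ _)) fun _ => rfl
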